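/- arXiv:2602.12455 — 9 statements merged into one kernel-verified Lean document; each statement's English description precedes it below -/
import Mathlib

section
/- Let f : ℝⁿ → ℝ ∪ {+∞} be e-quasiconvex and g : ℝⁿ → ℝ ∪ {+∞} be e′-quasiconvex, and suppose that (f(x) − f(y))(g(x) − g(y)) ≥ 0 for all x, y ∈ dom f ∩ dom g. Then f + g is (e + e′)-quasiconvex. In particular, if g is quasiconvex (so one may take e′ = 0), then f + g is e-quasiconvex. -/
/- Setting: functions ℝⁿ → ℝ ∪ {+∞} are modeled as `f : En n → EReal`
   together with the requirement `∀ x, f x ≠ ⊥`. -/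

noncomputable section

abbrev En (n : ℕ) := EuclideanSpace ℝ (Fin n)

/-- The effective domain of `f`. -/
def fdom {n : ℕ} (f : En n → EReal) : Set (En n) := {x | f x < ⊤}

/-- `f` is proper: it never takes the value `-∞` and its domain is nonempty. -/
def ProperFun {n : ℕ} (f : En n → EReal) : Prop :=
  (∀ x, f x ≠ ⊥) ∧ (fdom f).Nonempty

/-- `e` is an error bifunction: nonnegative, symmetric, with nonempty domain. -/
def IsErrorBifun {n : ℕ} (e : En n → En n → EReal) : Prop :=
  (∀ x y, 0 ≤ e x y) ∧ (∀ x y, e x y = e y x) ∧ (∃ x y, e x y < ⊤)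

/-- `f` is `e`-quasiconvex. -/
def EQuasiconvexOn {n : ℕ} (e : En n → En n → EReal) (f : En n → EReal) : Prop :=
  ∀ x y : En n, ∀ t : ℝ, t ∈ Set.Ioo (0:ℝ) 1 →
    f (t • x + (1 - t) • y) ≤ max (f x) (f y) + ((t * (1 - t) : ℝ) : EReal) * e x y

/-- `f` (with convex domain) is quasiconvex. -/
def QuasiconvexFun {n : ℕ} (f : En n → EReal) : Prop :=
  ∀ x ∈ fdom f, ∀ y ∈ fdom f, ∀ t ∈ Set.Icc (0:ℝ) 1,
    f (t • x + (1 - t) • y) ≤ max (f x) (f y)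

/-- Pairs that are ordered the same way have additive maxima. -/
theorem max_add_max_le_of_comonotone {a b c d : EReal}
    (ha : a ≠ ⊥) (hb : b ≠ ⊥) (hc : c ≠ ⊥) (hd : d ≠ ⊥)
    (h : a < ⊤ → c < ⊤ → b < ⊤ → d < ⊤ → 0 ≤ (a - b) * (c - d)) :
    max a b + max c d ≤ max (a + c) (b + d) := by
  by_cases hac : a + c = ⊤
  · simp [hac]
  by_cases hbd : b + d = ⊤
  · simp [hbd]
  have ha' : a ≠ ⊤ := fun h => hac (h ▸ EReal.top_add_of_ne_bot hc)
  have hc' : c ≠ ⊤ := fun h => hac (h ▸ EReal.add_top_of_ne_bot ha)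
  have hb' : b ≠ ⊤ := fun h => hbd (h ▸ EReal.top_add_of_ne_bot hd)
  have hd' : d ≠ ⊤ := fun h => hbd (h ▸ EReal.add_top_of_ne_bot hb)
  have hmul := h ha'.lt_top hc'.lt_top hb'.lt_top hd'.lt_top
  lift a to ℝ using ⟨ha', ha⟩
  lift b to ℝ using ⟨hb', hb⟩
  lift c to ℝ using ⟨hc', hc⟩
  lift d to ℝ using ⟨hd', hd⟩
  norm_cast at hmul
  rcases mul_nonneg_iff.1 hmul with ⟨hab, hcd⟩ | ⟨hab, hcd⟩
  · rw [max_eq_left (EReal.coe_le_coe_iff.2 (sub_nonneg.1 hab)),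
      max_eq_left (EReal.coe_le_coe_iff.2 (sub_nonneg.1 hcd))]
    exact le_max_left _ _
  · rw [max_eq_right (EReal.coe_le_coe_iff.2 (sub_nonpos.1 hab)),
      max_eq_right (EReal.coe_le_coe_iff.2 (sub_nonpos.1 hcd))]
    exact le_max_right _ _

theorem EQuasiconvexOn.add {n : ℕ} {f g : En n → EReal} {e e' : En n → En n → EReal}
    (he : ∀ x y, 0 ≤ e x y) (he' : ∀ x y, 0 ≤ e' x y)
    (hfbot : ∀ x, f x ≠ ⊥) (hgbot : ∀ x, g x ≠ ⊥)
    (hfe : EQuasiconvexOn e f) (hge : EQuasiconvexOn e' g)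
    (hmono : ∀ x ∈ fdom f ∩ fdom g, ∀ y ∈ fdom f ∩ fdom g,
      0 ≤ (f x - f y) * (g x - g y)) :
    EQuasiconvexOn (fun x y => e x y + e' x y) (fun x => f x + g x) := by
  intro x y t ht
  have hmax := max_add_max_le_of_comonotone (hfbot x) (hfbot y) (hgbot x) (hgbot y)
    fun hfx hgx hfy hgy => hmono x ⟨hfx, hgx⟩ y ⟨hfy, hgy⟩
  calc f (t • x + (1 - t) • y) + g (t • x + (1 - t) • y)
      ≤ (max (f x) (f y) + ((t * (1 - t) : ℝ) : EReal) * e x y) +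
          (max (g x) (g y) + ((t * (1 - t) : ℝ) : EReal) * e' x y) :=
        add_le_add (hfe x y t ht) (hge x y t ht)
    _ = (max (f x) (f y) + max (g x) (g y)) +
          ((t * (1 - t) : ℝ) : EReal) * (e x y + e' x y) := by
        rw [EReal.left_distrib_of_nonneg (he x y) (he' x y), add_add_add_comm]
    _ ≤ _ := add_le_add_left hmax _

theorem QuasiconvexFun.eQuasiconvexOn_zero {n : ℕ} {g : En n → EReal}
    (hg : QuasiconvexFun g) : EQuasiconvexOn (fun _ _ => 0) g := by
  intro x y t ht
  rw [mul_zero, add_zero]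
  by_cases hxy : max (g x) (g y) = ⊤
  · exact hxy ▸ le_top
  · obtain ⟨hx, hy⟩ := max_lt_iff.1 (lt_top_iff_ne_top.2 hxy)
    exact hg x hx y hy t ⟨ht.1.le, ht.2.le⟩

/-- if `f` is `e`-quasiconvex, `g` is `e'`-quasiconvex and
`(f(x) − f(y))(g(x) − g(y)) ≥ 0` on `dom f ∩ dom g`, then `f + g` is
`(e + e')`-quasiconvex; in particular, if `g` is quasiconvex then `f + g`
is `e`-quasiconvex. -/
theorem stmt4 {n : ℕ} (f g : En n → EReal) (e e' : En n → En n → EReal)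
    (he : IsErrorBifun e) (he' : IsErrorBifun e')
    (hfbot : ∀ x, f x ≠ ⊥) (hgbot : ∀ x, g x ≠ ⊥)
    (hfe : EQuasiconvexOn e f) (hge : EQuasiconvexOn e' g)
    (hmono : ∀ x ∈ fdom f ∩ fdom g, ∀ y ∈ fdom f ∩ fdom g,
      0 ≤ (f x - f y) * (g x - g y)) :
    EQuasiconvexOn (fun x y => e x y + e' x y) (fun x => f x + g x) ∧
      (QuasiconvexFun g → EQuasiconvexOn e (fun x => f x + g x)) := by
  refine ⟨hfe.add he.1 he'.1 hfbot hgbot hge hmono, fun hg => ?_⟩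
  simpa only [add_zero] using
    hfe.add he.1 (fun _ _ => le_rfl) hfbot hgbot hg.eQuasiconvexOn_zero hmono
end
end

section
/- Let f : ℝⁿ → ℝ ∪ {+∞} be a function for which the equation f(x) = 0 has two distinct roots x₁ and x₂. If limsup_{t → 0⁺} f(t x₁ + (1−t) x₂)/t = +∞, then there is no error bifunction e for which f is e-quasiconvex. -/
/- Setting: functions ℝⁿ → ℝ ∪ {+∞} are modeled as `f : En n → EReal`
   together with the requirement `∀ x, f x ≠ ⊥`. -/

noncomputable section

/-- if `f(x₁) = f(x₂) = 0` for distinct `x₁, x₂` and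
`limsup_{t→0⁺} f(t x₁ + (1−t) x₂)/t = +∞`, then there is no error bifunction `e`
for which `f` is `e`-quasiconvex. -/
theorem stmt6 {n : ℕ} (f : En n → EReal) (x₁ x₂ : En n)
    (hne : x₁ ≠ x₂) (h₁ : f x₁ = 0) (h₂ : f x₂ = 0)
    (hlim : Filter.limsup (fun t : ℝ => f (t • x₁ + (1 - t) • x₂) / (t : EReal))
        (nhdsWithin 0 (Set.Ioi 0)) = ⊤) :
    ¬ ∃ e : En n → En n → EReal, IsErrorBifun e ∧
        (∀ x ∈ fdom f, ∀ y ∈ fdom f, e x y < ⊤) ∧ EQuasiconvexOn e f := by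
  rintro ⟨e, ⟨he0, -, -⟩, hdom, hq⟩
  have htop : e x₁ x₂ < ⊤ := hdom x₁ (by simp [fdom, h₁]) x₂ (by simp [fdom, h₂])
  have hle : Filter.limsup (fun t : ℝ => f (t • x₁ + (1 - t) • x₂) / (t : EReal))
      (nhdsWithin 0 (Set.Ioi 0)) ≤ e x₁ x₂ := by
    refine Filter.limsup_le_of_le (by isBoundedDefault) ?_
    filter_upwards [Ioo_mem_nhdsGT (zero_lt_one' ℝ)] with t ht
    have hft := hq x₁ x₂ t ht
    rw [h₁, h₂, max_self, zero_add] at hft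
    rw [EReal.div_le_iff_le_mul (EReal.coe_pos.2 ht.1) (EReal.coe_ne_top t)]
    refine hft.trans (mul_le_mul_of_nonneg_right (EReal.coe_le_coe_iff.2 ?_) (he0 x₁ x₂))
    nlinarith [ht.1]
  exact (hle.trans_lt htop).ne hlim
end
end

section
/- A proper function f : ℝⁿ → ℝ ∪ {+∞} is e-convex if and only if for every x* ∈ ℝⁿ the function x ↦ f(x) + ⟨x*, x⟩ is e-quasiconvex. -/
/- Setting: functions ℝⁿ → ℝ ∪ {+∞} are modeled as `f : En n → EReal`
   together with the requirement `∀ x, f x ≠ ⊥`. -/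

noncomputable section

open RealInnerProductSpace

/-- `f` is `e`-convex. -/
def EConvexOn {n : ℕ} (e : En n → En n → EReal) (f : En n → EReal) : Prop :=
  ∀ x y : En n, ∀ t : ℝ, t ∈ Set.Ioo (0:ℝ) 1 →
    f (t • x + (1 - t) • y) ≤
      (t : EReal) * f x + ((1 - t : ℝ) : EReal) * f y + ((t * (1 - t) : ℝ) : EReal) * e x y

lemma EReal.top_add_coe_mul_eq_top {s : ℝ} (hs : 0 ≤ s) {u : EReal} (hu : 0 ≤ u) :
    (⊤ : EReal) + (s : EReal) * u = ⊤ :=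
  EReal.top_add_of_ne_bot
    (ne_bot_of_le_ne_bot EReal.zero_ne_bot (mul_nonneg (EReal.coe_nonneg.2 hs) hu))

lemma EReal.coe_mul_ne_bot {s : ℝ} (hs : 0 ≤ s) {u : EReal} (hu : u ≠ ⊥) :
    (s : EReal) * u ≠ ⊥ := by
  induction u with
  | bot => exact absurd rfl hu
  | coe r => exact_mod_cast EReal.coe_ne_bot (s * r)
  | top =>
    rcases hs.eq_or_lt with rfl | hs
    · simp
    · simp [EReal.coe_mul_top_of_pos hs]

/-- In a real inner product space, two distinct points can be assigned values of a linear functional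
with any prescribed difference. -/
lemma exists_inner_sub_eq {E : Type*} [NormedAddCommGroup E] [InnerProductSpace ℝ E]
    {x y : E} {r : ℝ} (h : x = y → r = 0) : ∃ v : E, ⟪v, x⟫ - ⟪v, y⟫ = r := by
  refine ⟨(r / ‖x - y‖ ^ 2) • (x - y), ?_⟩
  rw [← inner_sub_right, real_inner_smul_left, real_inner_self_eq_norm_sq]
  by_cases hxy : x = y
  · simp [hxy, h hxy]
  · have : ‖x - y‖ ≠ 0 := norm_ne_zero_iff.2 (sub_ne_zero.2 hxy)
    field_simp

/-- a proper `f` is `e`-convex iff for every `x*` the function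
`x ↦ f(x) + ⟨x*, x⟩` is `e`-quasiconvex. -/
theorem stmt8 {n : ℕ} (f : En n → EReal) (e : En n → En n → EReal)
    (hf : ProperFun f) (he : IsErrorBifun e)
    (hdome : ∀ x ∈ fdom f, ∀ y ∈ fdom f, e x y < ⊤) :
    EConvexOn e f ↔
      ∀ xstar : En n, EQuasiconvexOn e (fun x => f x + ((⟪xstar, x⟫ : ℝ) : EReal)) := by
  have hlin (v x y : En n) (t : ℝ) :
      ⟪v, t • x + (1 - t) • y⟫ = t * ⟪v, x⟫ + (1 - t) * ⟪v, y⟫ := by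
    rw [inner_add_right, real_inner_smul_right, real_inner_smul_right]
  have hreal (x y : En n) (hx : f x ≠ ⊤) (hy : f y ≠ ⊤) :
      ∃ a b c : ℝ, f x = a ∧ f y = b ∧ e x y = c :=
    ⟨_, _, _, (EReal.coe_toReal hx (hf.1 x)).symm, (EReal.coe_toReal hy (hf.1 y)).symm,
      (EReal.coe_toReal (hdome x (lt_top_iff_ne_top.2 hx) y (lt_top_iff_ne_top.2 hy)).ne
        (ne_bot_of_le_ne_bot EReal.zero_ne_bot (he.1 x y))).symm⟩
  constructor
  · intro h v x y t ht
    have hs : 0 ≤ t * (1 - t) := mul_nonneg ht.1.le (sub_nonneg.2 ht.2.le)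
    dsimp only
    by_cases hx : f x = ⊤
    · simp [hx, EReal.top_add_coe_mul_eq_top hs (he.1 x y), -EReal.coe_mul]
    by_cases hy : f y = ⊤
    · simp [hy, EReal.top_add_coe_mul_eq_top hs (he.1 x y), -EReal.coe_mul]
    obtain ⟨a, b, c, ha, hb, hc⟩ := hreal x y hx hy
    have key := h x y t ht
    rw [ha, hb, hc] at key ⊢
    rw [hlin]
    generalize f (t • x + (1 - t) • y) = u at key ⊢
    induction u with
    | bot => simp
    | top => exact absurd (top_le_iff.1 key) (by exact_mod_cast EReal.coe_ne_top _)
    | coe u =>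
      norm_cast at key ⊢
      rw [← EReal.coe_strictMono.monotone.map_max]
      norm_cast
      have h1 := mul_le_mul_of_nonneg_left (le_max_left (a + ⟪v, x⟫) (b + ⟪v, y⟫)) ht.1.le
      have h2 := mul_le_mul_of_nonneg_left (le_max_right (a + ⟪v, x⟫) (b + ⟪v, y⟫))
        (sub_nonneg.2 ht.2.le)
      linarith
  · intro h x y t ht
    have ht' : 0 < 1 - t := sub_pos.2 ht.2
    have hs : 0 ≤ t * (1 - t) := mul_nonneg ht.1.le ht'.le
    by_cases hx : f x = ⊤
    · rw [hx, EReal.coe_mul_top_of_pos ht.1,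
        EReal.top_add_of_ne_bot (EReal.coe_mul_ne_bot ht'.le (hf.1 y)),
        EReal.top_add_coe_mul_eq_top hs (he.1 x y)]
      exact le_top
    by_cases hy : f y = ⊤
    · rw [hy, EReal.coe_mul_top_of_pos ht',
        EReal.add_top_of_ne_bot (EReal.coe_mul_ne_bot ht.1.le (hf.1 x)),
        EReal.top_add_coe_mul_eq_top hs (he.1 x y)]
      exact le_top
    obtain ⟨a, b, c, ha, hb, hc⟩ := hreal x y hx hy
    obtain ⟨v, hv⟩ : ∃ v : En n, ⟪v, x⟫ - ⟪v, y⟫ = b - a := by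
      refine exists_inner_sub_eq fun hxy => ?_
      rw [hxy, hb] at ha
      exact sub_eq_zero.2 (EReal.coe_injective ha)
    have key := h v x y t ht
    dsimp only at key
    rw [ha, hb, hc] at key
    rw [ha, hb, hc]
    rw [hlin] at key
    generalize f (t • x + (1 - t) • y) = u at key ⊢
    induction u with
    | bot => simp
    | top =>
      rw [EReal.top_add_coe] at key
      exact absurd (top_le_iff.1 key) (by exact_mod_cast EReal.coe_ne_top _)
    | coe u =>
      norm_cast at key ⊢
      have hab : a + ⟪v, x⟫ = b + ⟪v, y⟫ := by linarith
      rw [hab, max_self] at key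
      have hxv : ⟪v, x⟫ = b + ⟪v, y⟫ - a := by linarith
      rw [hxv] at key
      norm_cast at key
      linarith
end
end

section
/- Let f : ℝⁿ → ℝ ∪ {+∞} be a proper, lower semicontinuous, e-quasiconvex function, where the error bifunction e is upper semicontinuous and positively homogeneous in the sense that e(λx, λy) = λ e(x,y) for all λ ≥ 0 and all x, y. If f_q^∞(u) − e(u, 0) > 0 for every u ≠ 0, then the set argmin_{ℝⁿ} f of global minimizers of f is nonempty and compact. -/
/- Setting: functions ℝⁿ → ℝ ∪ {+∞} are modeled as `f : En n → EReal`
   together with the requirement `∀ x, f x ≠ ⊥`. -/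

noncomputable section

/-- The `q`-asymptotic function
`f_q^∞(u) = sup_{x ∈ dom f} sup_{t > 0} (f(x + tu) − f(x))/t`. -/
noncomputable def qAsymp {n : ℕ} (f : En n → EReal) (u : En n) : EReal :=
  ⨆ x ∈ fdom f, ⨆ t ∈ Set.Ioi (0:ℝ), (f (x + t • u) - f x) / (t : EReal)

open Filter Topology Bornology

/-- If `f` tends to its infimum along an ultrafilter `U` that escapes to infinity in the asymptotic
direction `u`, then `f_q^∞(u) ≤ e(u, 0)`. -/
theorem qAsymp_le_of_tendsto_iInf {n : ℕ} {f : En n → EReal} {e : En n → En n → EReal}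
    (hbot : ∀ x, f x ≠ ⊥) (hlsc : LowerSemicontinuous f) (hnonneg : ∀ x y, 0 ≤ e x y)
    (husc : UpperSemicontinuous (fun p : En n × En n => e p.1 p.2))
    (hhom : ∀ lam : ℝ, 0 ≤ lam → ∀ x y : En n,
      e (lam • x) (lam • y) = (lam : EReal) * e x y)
    (hfe : EQuasiconvexOn e f) {u : En n} {U : Filter (En n)} [U.NeBot]
    (hfU : Tendsto f U (𝓝 (⨅ x, f x))) (hU : Tendsto (fun x : En n => ‖x‖) U atTop)
    (hdir : Tendsto (fun x : En n => ‖x‖⁻¹ • x) U (𝓝 u)) (hu : e u 0 ≠ ⊤) :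
    qAsymp f u ≤ e u 0 := by
  refine iSup₂_le fun x hx => iSup₂_le fun t (ht : 0 < t) => ?_
  have hinv : Tendsto (fun y : En n => ‖y‖⁻¹) U (𝓝 0) := tendsto_inv_atTop_zero.comp hU
  have hz : Tendsto (fun y : En n => (t * ‖y‖⁻¹) • y + (1 - t * ‖y‖⁻¹) • x) U
      (𝓝 (x + t • u)) := by
    have h : Tendsto (fun y : En n => t • (‖y‖⁻¹ • y) + (1 - t * ‖y‖⁻¹) • x) U
        (𝓝 (t • u + (1 - t * 0) • x)) :=
      (hdir.const_smul t).add ((tendsto_const_nhds.sub (hinv.const_mul t)).smul_const x)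
    simpa [mul_smul, add_comm] using h
  have hpair : Tendsto (fun y : En n => (‖y‖⁻¹ • y, ‖y‖⁻¹ • x)) U (𝓝 (u, 0)) := by
    have h := hinv.smul_const x
    rw [zero_smul] at h
    exact hdir.prodMk_nhds h
  obtain ⟨a, ha⟩ : ∃ a : ℝ, f x = a :=
    ⟨_, (EReal.coe_toReal (ne_of_lt hx) (hbot x)).symm⟩
  obtain ⟨b, hb⟩ : ∃ b : ℝ, e u 0 = b :=
    ⟨_, (EReal.coe_toReal hu (ne_of_gt (EReal.bot_lt_zero.trans_le (hnonneg u 0)))).symm⟩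
  have key : ∀ d : ℝ, b < d → f (x + t • u) ≤ ((a + t * d : ℝ) : EReal) := by
    intro d hd
    by_contra! hlt
    obtain ⟨c, hbc, hcd⟩ := exists_between hd
    have h₁ := hz.eventually (hlsc _ _ hlt)
    have h₂ : ∀ᶠ y in U, e (‖y‖⁻¹ • y) (‖y‖⁻¹ • x) < (c : EReal) :=
      hpair.eventually (husc (u, 0) c (by simpa [hb] using hbc))
    have h₃ : ∀ᶠ y in U, f y < ((a + t * (d - c) : ℝ) : EReal) := by
      refine hfU.eventually_lt_const ((iInf_le f x).trans_lt ?_)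
      rw [ha, EReal.coe_lt_coe_iff]
      have := mul_pos ht (sub_pos.2 hcd)
      linarith
    obtain ⟨y, hy₁, hy₂, hy₃, hyt⟩ :=
      (h₁.and (h₂.and (h₃.and (hU.eventually_gt_atTop t)))).exists
    have hy0 : 0 < ‖y‖ := ht.trans hyt
    have hs0 : 0 < t * ‖y‖⁻¹ := by positivity
    have hs1 : t * ‖y‖⁻¹ < 1 := by
      rw [← div_eq_mul_inv, div_lt_one hy0]
      exact hyt
    refine absurd (hfe y x _ ⟨hs0, hs1⟩) (not_le.2 (lt_of_le_of_lt ?_ hy₁))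
    have hmax : max (f y) (f x) ≤ ((a + t * (d - c) : ℝ) : EReal) := by
      refine max_le hy₃.le ?_
      rw [ha, EReal.coe_le_coe_iff]
      have := mul_pos ht (sub_pos.2 hcd)
      linarith
    have herr : ((t * ‖y‖⁻¹ * (1 - t * ‖y‖⁻¹) : ℝ) : EReal) * e y x ≤ ((t * c : ℝ) : EReal) := by
      have h := hhom ‖y‖⁻¹ (by positivity) y x
      have hs : t * ‖y‖⁻¹ * (1 - t * ‖y‖⁻¹) ≤ t * ‖y‖⁻¹ := by nlinarith
      calc ((t * ‖y‖⁻¹ * (1 - t * ‖y‖⁻¹) : ℝ) : EReal) * e y x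
          ≤ ((t * ‖y‖⁻¹ : ℝ) : EReal) * e y x :=
            mul_le_mul_of_nonneg_right (EReal.coe_le_coe_iff.2 hs) (hnonneg y x)
        _ = (t : EReal) * e (‖y‖⁻¹ • y) (‖y‖⁻¹ • x) := by
            rw [h, EReal.coe_mul, mul_assoc]
        _ ≤ (t : EReal) * (c : EReal) :=
            mul_le_mul_of_nonneg_left hy₂.le (EReal.coe_nonneg.2 ht.le)
        _ = ((t * c : ℝ) : EReal) := (EReal.coe_mul _ _).symm
    calc max (f y) (f x) + ((t * ‖y‖⁻¹ * (1 - t * ‖y‖⁻¹) : ℝ) : EReal) * e y x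
        ≤ ((a + t * (d - c) : ℝ) : EReal) + ((t * c : ℝ) : EReal) := add_le_add hmax herr
      _ = ((a + t * d : ℝ) : EReal) := by rw [← EReal.coe_add]; congr 1; ring
  obtain ⟨g, hg⟩ : ∃ g : ℝ, f (x + t • u) = g :=
    ⟨_, (EReal.coe_toReal (ne_of_lt ((key (b + 1) (by linarith)).trans_lt (EReal.coe_lt_top _)))
      (hbot _)).symm⟩
  rw [ha, hb, hg, ← EReal.coe_sub, ← EReal.coe_div, EReal.coe_le_coe_iff]
  refine le_of_forall_gt_imp_ge_of_dense fun d hd => ?_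
  have h := key d hd
  rw [hg, EReal.coe_le_coe_iff] at h
  rw [div_le_iff₀ ht]
  linarith

/-- Some sublevel set strictly above the infimum is bounded. -/
theorem exists_iInf_lt_isBounded_sublevel {n : ℕ} {f : En n → EReal} {e : En n → En n → EReal}
    (hf : ProperFun f) (hlsc : LowerSemicontinuous f) (hnonneg : ∀ x y, 0 ≤ e x y)
    (husc : UpperSemicontinuous (fun p : En n × En n => e p.1 p.2))
    (hhom : ∀ lam : ℝ, 0 ≤ lam → ∀ x y : En n,
      e (lam • x) (lam • y) = (lam : EReal) * e x y)
    (hfe : EQuasiconvexOn e f) (hcond : ∀ u : En n, u ≠ 0 → e u 0 < qAsymp f u) :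
    ∃ c, (⨅ x, f x) < c ∧ IsBounded {x | f x < c} := by
  obtain ⟨hbot, x₀, hx₀⟩ := hf
  by_contra! hunb
  have hne : (comap f (𝓝 (⨅ x, f x)) ⊓ cobounded (En n)).NeBot := by
    refine ⟨fun h => ?_⟩
    obtain ⟨s, ⟨V, hV, hVs⟩, t, ht, hst⟩ := Filter.inf_eq_bot_iff.1 h
    obtain ⟨c, hc, hcV⟩ := exists_Ico_subset_of_mem_nhds hV ⟨⊤, (iInf_le f x₀).trans_lt hx₀⟩
    refine hunb c hc ((isBounded_compl_iff.2 (isCobounded_def.2 ht)).subset fun x hx hxt => ?_)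
    exact (Set.mem_empty_iff_false x).1
      (hst ▸ ⟨hVs (hcV ⟨iInf_le f x, hx⟩), hxt⟩)
  obtain ⟨U, hU⟩ := Ultrafilter.exists_le (comap f (𝓝 (⨅ x, f x)) ⊓ cobounded (En n))
  have hfU : Tendsto f U (𝓝 (⨅ x, f x)) := tendsto_iff_comap.2 (hU.trans inf_le_left)
  have hnorm : Tendsto (fun x : En n => ‖x‖) U atTop :=
    tendsto_norm_cobounded_atTop.mono_left (hU.trans inf_le_right)
  have hsphere : ∀ᶠ x : En n in U, ‖x‖⁻¹ • x ∈ Metric.sphere (0 : En n) 1 := by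
    filter_upwards [hnorm.eventually_gt_atTop 0] with x hx
    simp [norm_smul, hx.ne']
  obtain ⟨u, hu, hdir⟩ := (isCompact_sphere (0 : En n) 1).ultrafilter_le_nhds
    (U.map fun x => ‖x‖⁻¹ • x) (le_principal_iff.2 hsphere)
  have hlt := hcond u (ne_zero_of_mem_unit_sphere ⟨u, hu⟩)
  exact hlt.not_ge
    (qAsymp_le_of_tendsto_iInf hbot hlsc hnonneg husc hhom hfe hfU hnorm hdir hlt.ne_top)

/-- if `f` is proper, lsc and `e`-quasiconvex, where `e` is usc and
positively homogeneous, and `f_q^∞(u) − e(u,0) > 0` for all `u ≠ 0`, then the set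
of global minimizers of `f` is nonempty and compact. -/
theorem stmt9 {n : ℕ} (f : En n → EReal) (e : En n → En n → EReal)
    (hf : ProperFun f) (hlsc : LowerSemicontinuous f)
    (he : IsErrorBifun e)
    (husc : UpperSemicontinuous (fun p : En n × En n => e p.1 p.2))
    (hhom : ∀ lam : ℝ, 0 ≤ lam → ∀ x y : En n,
      e (lam • x) (lam • y) = (lam : EReal) * e x y)
    (hdome : ∀ x ∈ fdom f, ∀ y ∈ fdom f, e x y < ⊤)
    (hfe : EQuasiconvexOn e f)
    (hcond : ∀ u : En n, u ≠ 0 → e u 0 < qAsymp f u) :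
    {x : En n | ∀ y : En n, f x ≤ f y}.Nonempty ∧
      IsCompact {x : En n | ∀ y : En n, f x ≤ f y} := by
  obtain ⟨c, hc, hbdd⟩ := exists_iInf_lt_isBounded_sublevel hf hlsc he.1 husc hhom hfe hcond
  have hclosed : ∀ a, IsClosed {x | f x ≤ a} := fun a => hlsc.isClosed_preimage a
  obtain ⟨x₁, hx₁⟩ := iInf_lt_iff.1 hc
  have hcomp : IsCompact {x | f x ≤ f x₁} :=
    Metric.isCompact_of_isClosed_isBounded (hclosed _) (hbdd.subset fun x hx => hx.trans_lt hx₁)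
  obtain ⟨x, hx, hmin⟩ := (hlsc.lowerSemicontinuousOn _).exists_isMinOn ⟨x₁, le_refl (f x₁)⟩ hcomp
  refine ⟨⟨x, fun y => ?_⟩, ?_⟩
  · rcases le_total (f y) (f x₁) with hy | hy
    · exact hmin hy
    · exact hx.trans hy
  · refine hcomp.of_isClosed_subset ?_ fun y hy => hy x₁
    rw [Set.ofPred_forall]
    exact isClosed_iInter fun y => hclosed (f y)
end
end

section
/- Let Ω ⊆ ℝⁿ be a nonempty closed convex set and f : ℝⁿ → ℝ ∪ {+∞} a proper function with Ω ⊆ dom f, and let ι_Ω denote the indicator function of Ω (equal to 0 on Ω and +∞ off Ω). Then for every d ∈ ℝⁿ: if d ∈ Ω^∞ then (f + ι_Ω)_q^∞(d) = sup_{x ∈ Ω} sup_{t > 0} ( f(x + td) − f(x) ) / t, and if d ∉ Ω^∞ then (f + ι_Ω)_q^∞(d) = +∞. -/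
/- Setting: functions ℝⁿ → ℝ ∪ {+∞} are modeled as `f : En n → EReal`
   together with the requirement `∀ x, f x ≠ ⊥`. -/

noncomputable section

/-- The asymptotic (recession) cone of a closed convex set. -/
def recCone {n : ℕ} (Ω : Set (En n)) : Set (En n) :=
  {u | ∀ x ∈ Ω, ∀ lam : ℝ, 0 ≤ lam → x + lam • u ∈ Ω}

open Classical in
/-- The indicator function of `Ω` (0 on `Ω`, `+∞` off `Ω`). -/
noncomputable def indicatorFun {n : ℕ} (Ω : Set (En n)) : En n → EReal :=
  fun x => if x ∈ Ω then (0 : EReal) else ⊤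

theorem add_indicatorFun_of_mem {n : ℕ} {Ω : Set (En n)} (f : En n → EReal) {x : En n}
    (hx : x ∈ Ω) : f x + indicatorFun Ω x = f x := by
  simp [indicatorFun, hx]

theorem add_indicatorFun_of_notMem {n : ℕ} {Ω : Set (En n)} {f : En n → EReal} {x : En n}
    (hfx : f x ≠ ⊥) (hx : x ∉ Ω) : f x + indicatorFun Ω x = ⊤ := by
  simp [indicatorFun, hx, EReal.add_top_of_ne_bot hfx]

theorem fdom_add_indicatorFun {n : ℕ} {Ω : Set (En n)} {f : En n → EReal}
    (hf : ∀ x, f x ≠ ⊥) (hsub : Ω ⊆ fdom f) :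
    fdom (fun x => f x + indicatorFun Ω x) = Ω := by
  ext x
  by_cases hx : x ∈ Ω
  · simpa [fdom, add_indicatorFun_of_mem f hx, hx] using hsub hx
  · simp [fdom, add_indicatorFun_of_notMem (hf x) hx, hx]

/-- for a nonempty closed convex `Ω ⊆ dom f` and proper `f`, the
`q`-asymptotic function of `f + ι_Ω` equals
`sup_{x ∈ Ω} sup_{t > 0} (f(x+td) − f(x))/t` when `d ∈ Ω^∞`, and `+∞` when `d ∉ Ω^∞`. -/
theorem stmt11 {n : ℕ} (Ω : Set (En n)) (f : En n → EReal)
    (hΩne : Ω.Nonempty) (hΩcl : IsClosed Ω) (hΩcv : Convex ℝ Ω)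
    (hf : ProperFun f) (hsub : Ω ⊆ fdom f) :
    ∀ d : En n,
      (d ∈ recCone Ω →
        qAsymp (fun x => f x + indicatorFun Ω x) d =
          ⨆ x ∈ Ω, ⨆ t ∈ Set.Ioi (0:ℝ), (f (x + t • d) - f x) / (t : EReal)) ∧
      (d ∉ recCone Ω →
        qAsymp (fun x => f x + indicatorFun Ω x) d = ⊤) := by
  intro d
  unfold qAsymp
  rw [fdom_add_indicatorFun hf.1 hsub]
  refine ⟨fun hd => ?_, fun hd => ?_⟩
  · refine biSup_congr fun x hx => biSup_congr fun t ht => ?_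
    beta_reduce
    rw [add_indicatorFun_of_mem f hx, add_indicatorFun_of_mem f (hd x hx t (le_of_lt ht))]
  · simp only [recCone, Set.mem_ofPred_eq, not_forall] at hd
    obtain ⟨x, hx, t, ht, hxt⟩ := hd
    have ht' : 0 < t := ht.lt_of_ne fun h => hxt (by simpa [← h] using hx)
    refine top_le_iff.mp (le_iSup₂_of_le x hx (le_iSup₂_of_le t ht' ?_))
    beta_reduce
    rw [add_indicatorFun_of_mem f hx, add_indicatorFun_of_notMem (hf.1 _) hxt,
      EReal.top_sub (hsub hx).ne,
      EReal.top_div_of_pos_ne_top (EReal.coe_pos.mpr ht') (EReal.coe_ne_top t)]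
end
end

section
/- Let K ⊆ ℝⁿ be an open convex set, f : K → ℝ, g = (g₁,…,g_m) : K → ℝᵐ and h = (h₁,…,h_k) : K → ℝᵏ be Gâteaux differentiable at x̄ ∈ C′ := {x ∈ K : gᵢ(x) ≤ 0 for all i, hⱼ(x) = 0 for all j}, with gradients ∇f(x̄), ∇gᵢ(x̄), ∇hⱼ(x̄), and let e = (e₁,…,e_m) with each eᵢ : ℝⁿ × ℝⁿ → ℝ an error bifunction. Assume there exists (ū, v̄) ∈ ℝ₊ᵐ × ℝᵏ with (ū, v̄) ≠ (0, 0) such that ⟨∇f(x̄) + Σᵢ ūᵢ ∇gᵢ(x̄) + Σⱼ v̄ⱼ ∇hⱼ(x̄), x − x̄⟩ ≥ Σᵢ ūᵢ eᵢ(x, x̄) for all x ∈ K, and Σᵢ ūᵢ gᵢ(x̄) = 0. Then x̄ is a global minimum of f on C̃ := {x ∈ K : g(x) ∈ −ℝ₊ᵐ + L(g(x̄)), h(x) = 0} if and only if the map (f, g, h) : K → ℝ × ℝᵐ × ℝᵏ is Ĉ-ê-quasiconvex at x̄, where ê := (0, e, 0) and Ĉ := (ℝ₋ \ {0}) × (−ℝ₊ᵐ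 + L(g(x̄))) × {0}, with L(v) the linear span of v. -/
/- Setting for the differentiable KKT results: real-valued functions on an open
convex subset `K` of `ℝⁿ = EuclideanSpace ℝ (Fin n)`; Gâteaux differentiability
at `x̄` is expressed through gradients: the directional derivative in every
direction `w` exists and equals the inner product of the gradient with `w`. -/

noncomputable section

open RealInnerProductSpace Filter

/-- `e` is a real-valued error bifunction: nonnegative and symmetric. -/
def IsErrorBifunR {n : ℕ} (e : En n → En n → ℝ) : Prop :=
  (∀ x y, 0 ≤ e x y) ∧ (∀ x y, e x y = e y x)

/-- Gâteaux differentiability of `φ` at `x̄` with gradient `Gφ`: for every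
direction `w`, the directional derivative exists and equals `⟪Gφ, w⟫`. -/
def HasGateauxGradAt {n : ℕ} (φ : En n → ℝ) (Gφ : En n) (xbar : En n) : Prop :=
  ∀ w : En n,
    Tendsto (fun t : ℝ => (φ (xbar + t • w) - φ xbar) / t)
      (nhdsWithin 0 (Set.Ioi 0)) (nhds (⟪Gφ, w⟫ : ℝ))

/-- The set `−ℝ₊ᵐ + 𝓛(w₀)` ⊆ ℝᵐ (sum of the nonpositive orthant and the linear
span of `w₀`). -/
def negOrthPlusSpan {m : ℕ} (w₀ : Fin m → ℝ) : Set (Fin m → ℝ) :=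
  {v | ∃ w : Fin m → ℝ, (∀ i, 0 ≤ w i) ∧
    ∃ c ∈ (Submodule.span ℝ {w₀} : Submodule ℝ (Fin m → ℝ)), v = -w + c}

theorem sub_mem_negOrthPlusSpan_iff {m : ℕ} (v w₀ : Fin m → ℝ) :
    (fun i => v i - w₀ i) ∈ negOrthPlusSpan w₀ ↔ v ∈ negOrthPlusSpan w₀ := by
  have hw₀ := Submodule.mem_span_singleton_self (R := ℝ) w₀
  constructor
  · rintro ⟨w, hw, c, hc, hv⟩
    refine ⟨w, hw, c + w₀, add_mem hc hw₀, ?_⟩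
    rw [← add_assoc, ← hv]
    ext i
    simp
  · rintro ⟨w, hw, c, hc, hv⟩
    refine ⟨w, hw, c - w₀, sub_mem hc hw₀, ?_⟩
    rw [← add_sub_assoc, ← hv]
    rfl

/-- A nonnegative vector orthogonal to `w₀` lies in the polar of `−ℝ₊ᵐ + 𝓛(w₀)`. -/
theorem sum_mul_nonpos_of_mem_negOrthPlusSpan {m : ℕ} {u v w₀ : Fin m → ℝ}
    (hu : ∀ i, 0 ≤ u i) (huw : ∑ i, u i * w₀ i = 0) (hv : v ∈ negOrthPlusSpan w₀) :
    ∑ i, u i * v i ≤ 0 := by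
  obtain ⟨w, hw, c, hc, rfl⟩ := hv
  obtain ⟨a, rfl⟩ := Submodule.mem_span_singleton.mp hc
  have hsum : ∑ i, u i * (-w + a • w₀) i = a * (∑ i, u i * w₀ i) - ∑ i, u i * w i := by
    rw [Finset.mul_sum, ← Finset.sum_sub_distrib]
    refine Finset.sum_congr rfl fun i _ => ?_
    simp only [Pi.add_apply, Pi.neg_apply, Pi.smul_apply, smul_eq_mul]
    ring
  have hnonneg : 0 ≤ ∑ i, u i * w i :=
    Finset.sum_nonneg fun i _ => mul_nonneg (hu i) (hw i)
  rw [hsum, huw]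
  linarith

/-- with the KKT-type multiplier condition, `x̄` is a global minimum
of `f` on `C̃ = {x ∈ K : g(x) ∈ −ℝ₊ᵐ + 𝓛(g(x̄)), h(x) = 0}` iff the map `(f, g, h)`
is `Ĉ`-`ê`-quasiconvex at `x̄`, where `ê = (0, e, 0)` and
`Ĉ = (ℝ₋ \ {0}) × (−ℝ₊ᵐ + 𝓛(g(x̄))) × {0}`. -/
theorem stmt12 {n m k : ℕ} (K : Set (En n))
    (f : En n → ℝ) (g : Fin m → En n → ℝ) (h : Fin k → En n → ℝ)
    (xbar : En n) (Gf : En n) (Gg : Fin m → En n) (Gh : Fin k → En n)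
    (e : Fin m → En n → En n → ℝ) (ubar : Fin m → ℝ) (vbar : Fin k → ℝ)
    (hK : IsOpen K) (hKcv : Convex ℝ K)
    (hxK : xbar ∈ K) (hxg : ∀ i, g i xbar ≤ 0) (hxh : ∀ j, h j xbar = 0)
    (hdf : HasGateauxGradAt f Gf xbar)
    (hdg : ∀ i, HasGateauxGradAt (g i) (Gg i) xbar)
    (hdh : ∀ j, HasGateauxGradAt (h j) (Gh j) xbar)
    (he : ∀ i, IsErrorBifunR (e i))
    (hu : ∀ i, 0 ≤ ubar i)
    (huv : ¬ (ubar = 0 ∧ vbar = 0))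
    (hineq : ∀ x ∈ K,
      (∑ i, ubar i * e i x xbar) ≤
        ⟪Gf + (∑ i, ubar i • Gg i) + (∑ j, vbar j • Gh j), x - xbar⟫)
    (hcomp : (∑ i, ubar i * g i xbar) = 0) :
    (∀ x ∈ K, ((fun i => g i x) ∈ negOrthPlusSpan (fun i => g i xbar) ∧ ∀ j, h j x = 0) →
        f xbar ≤ f x)
      ↔
    (∀ x ∈ K,
      (f x - f xbar < 0 ∧
        (fun i => g i x - g i xbar) ∈ negOrthPlusSpan (fun i => g i xbar) ∧
        (∀ j, h j x - h j xbar = 0)) →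
      ((⟪Gf, x - xbar⟫ : ℝ) < 0 ∧
        (fun i => (⟪Gg i, x - xbar⟫ : ℝ) - e i x xbar) ∈ negOrthPlusSpan (fun i => g i xbar) ∧
        (∀ j, (⟪Gh j, x - xbar⟫ : ℝ) = 0))) := by
  constructor
  · rintro hmin x hx ⟨hfx, hgx, hhx⟩
    have := hmin x hx ⟨(sub_mem_negOrthPlusSpan_iff _ _).mp hgx,
      fun j => by simpa [hxh j] using hhx j⟩
    linarith
  · rintro hq x hx ⟨hgx, hhx⟩
    by_contra! hlt
    obtain ⟨hf, hg, hh⟩ := hq x hx ⟨sub_neg.mpr hlt,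
      (sub_mem_negOrthPlusSpan_iff (fun i => g i x) _).mpr hgx,
      fun j => by rw [hhx j, hxh j, sub_zero]⟩
    have hpolar := sum_mul_nonpos_of_mem_negOrthPlusSpan hu hcomp hg
    have hkkt := hineq x hx
    simp only [inner_add_left, sum_inner, real_inner_smul_left, hh, mul_zero,
      Finset.sum_const_zero] at hkkt
    simp only [mul_sub, Finset.sum_sub_distrib] at hpolar
    linarith
end
end

section
/- Let K ⊆ ℝⁿ be an open convex set, f : K → ℝ, g = (g₁,…,g_m) : K → ℝᵐ and h = (h₁,…,h_k) : K → ℝᵏ be Gâteaux differentiable at x̄ ∈ C′ := {x ∈ K : gᵢ(x) ≤ 0 for all i, hⱼ(x) = 0 for all j}, with gradients ∇f(x̄), ∇gᵢ(x̄), ∇hⱼ(x̄), and let e = (e₁,…,e_m) with each eᵢ : ℝⁿ × ℝⁿ → ℝ an error bifunction. Assume there exists (ū, v̄) ∈ ℝ₊ᵐ × ℝᵏ with (ū, v̄) ≠ (0, 0) such that ⟨∇f(x̄) + Σᵢ ūᵢ ∇gᵢ(x̄) + Σⱼ v̄ⱼ ∇hⱼ(x̄), x − x̄⟩ ≥ Σᵢ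 ūᵢ eᵢ(x, x̄) for all x ∈ K, and Σᵢ ūᵢ gᵢ(x̄) = 0. If the map (f, g, h) : K → ℝ × ℝᵐ × ℝᵏ is Ĉ-ê-quasiconvex at x̄ with ê := (0, e, 0) and Ĉ := (ℝ₋ \ {0}) × (−ℝ₊ᵐ + L(g(x̄))) × {0}, then x̄ is a global minimum of f on C′. -/
/- Setting for the differentiable KKT results: real-valued functions on an open
convex subset `K` of `ℝⁿ = EuclideanSpace ℝ (Fin n)`; Gâteaux differentiability
at `x̄` is expressed through gradients: the directional derivative in every
direction `w` exists and equals the inner product of the gradient with `w`. -/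

noncomputable section

open RealInnerProductSpace Filter

theorem sub_mem_negOrthPlusSpan {m : ℕ} {v w₀ : Fin m → ℝ} (hv : ∀ i, v i ≤ 0) :
    v - w₀ ∈ negOrthPlusSpan w₀ :=
  ⟨-v, fun i => neg_nonneg.mpr (hv i), -w₀,
    neg_mem (Submodule.mem_span_singleton_self w₀), by rw [neg_neg, sub_eq_add_neg]⟩

/-- under the KKT-type multiplier condition, if the map `(f, g, h)`
is `Ĉ`-`ê`-quasiconvex at `x̄` (with `ê = (0, e, 0)` and
`Ĉ = (ℝ₋ \ {0}) × (−ℝ₊ᵐ + 𝓛(g(x̄))) × {0}`), then `x̄` is a global minimum of `f`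
on `C' = {x ∈ K : g(x) ≤ 0, h(x) = 0}`. -/
theorem stmt13 {n m k : ℕ} (K : Set (En n))
    (f : En n → ℝ) (g : Fin m → En n → ℝ) (h : Fin k → En n → ℝ)
    (xbar : En n) (Gf : En n) (Gg : Fin m → En n) (Gh : Fin k → En n)
    (e : Fin m → En n → En n → ℝ) (ubar : Fin m → ℝ) (vbar : Fin k → ℝ)
    (hK : IsOpen K) (hKcv : Convex ℝ K)
    (hxK : xbar ∈ K) (hxg : ∀ i, g i xbar ≤ 0) (hxh : ∀ j, h j xbar = 0)
    (hdf : HasGateauxGradAt f Gf xbar)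
    (hdg : ∀ i, HasGateauxGradAt (g i) (Gg i) xbar)
    (hdh : ∀ j, HasGateauxGradAt (h j) (Gh j) xbar)
    (he : ∀ i, IsErrorBifunR (e i))
    (hu : ∀ i, 0 ≤ ubar i)
    (huv : ¬ (ubar = 0 ∧ vbar = 0))
    (hineq : ∀ x ∈ K,
      (∑ i, ubar i * e i x xbar) ≤
        ⟪Gf + (∑ i, ubar i • Gg i) + (∑ j, vbar j • Gh j), x - xbar⟫)
    (hcomp : (∑ i, ubar i * g i xbar) = 0)
    (hCe : ∀ x ∈ K,
      (f x - f xbar < 0 ∧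
        (fun i => g i x - g i xbar) ∈ negOrthPlusSpan (fun i => g i xbar) ∧
        (∀ j, h j x - h j xbar = 0)) →
      ((⟪Gf, x - xbar⟫ : ℝ) < 0 ∧
        (fun i => (⟪Gg i, x - xbar⟫ : ℝ) - e i x xbar) ∈ negOrthPlusSpan (fun i => g i xbar) ∧
        (∀ j, (⟪Gh j, x - xbar⟫ : ℝ) = 0))) :
    ∀ x ∈ K, ((∀ i, g i x ≤ 0) ∧ ∀ j, h j x = 0) → f xbar ≤ f x := by
  rintro x hx ⟨hgx, hhx⟩
  by_contra! hlt
  obtain ⟨hGf, hGg, hGh⟩ := hCe x hx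
    ⟨sub_neg.mpr hlt, sub_mem_negOrthPlusSpan hgx, fun j => by rw [hhx, hxh, sub_zero]⟩
  have hsum := sum_mul_nonpos_of_mem_negOrthPlusSpan hu hcomp hGg
  have hkkt := hineq x hx
  simp only [inner_add_left, sum_inner, real_inner_smul_left, hGh, mul_zero,
    Finset.sum_const_zero, add_zero] at hkkt
  simp only [mul_sub, Finset.sum_sub_distrib] at hsum
  linarith
end
end

section
/- Let K ⊆ ℝⁿ be an open convex set, f : K → ℝ pseudoconvex and differentiable at x̄ ∈ K, and for each i = 1,…,m let gᵢ : K → ℝ be eᵢ-quasiconvex and differentiable at x̄, where each eᵢ : ℝⁿ × ℝⁿ → ℝ is an error bifunction with eᵢ(·, y) convex for each y and eᵢ(x, x) = 0 for all x. Assume C := {x ∈ K : gᵢ(x) ≤ 0 for all i} is convex and that there exists ū ∈ ℝᵐ such that: (i) ⟨∇f(x̄) + Σᵢ ūᵢ ∇gᵢ(x̄), x − x̄⟩ ≥ Σᵢ ūᵢ eᵢ(x, x̄) for all x ∈ C; (ii) Σᵢ ūᵢ gᵢ(x̄) = 0; (iii) gᵢ(x̄) ≤ 0 for all i; (iv) ū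 ≥ 0. Then x̄ is a global minimum of f on C. -/
/- Setting: real-valued functions on an open convex `K ⊆ ℝⁿ`;
`HasGradientAt φ Gφ x` is Mathlib's gradient for functions on a Hilbert space. -/

noncomputable section

open RealInnerProductSpace

/-- `g` is `e`-quasiconvex on the convex set `K`. -/
def EQuasiconvexOnR {n : ℕ} (K : Set (En n)) (e : En n → En n → ℝ) (g : En n → ℝ) : Prop :=
  ∀ x ∈ K, ∀ y ∈ K, ∀ t ∈ Set.Ioo (0:ℝ) 1,
    g (t • x + (1 - t) • y) ≤ max (g x) (g y) + t * (1 - t) * e x y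

/-- A differentiable `f` (with gradient field `Gf`) is pseudoconvex on `K`. -/
def PseudoconvexOnR {n : ℕ} (K : Set (En n)) (f : En n → ℝ) (Gf : En n → En n) : Prop :=
  ∀ x ∈ K, ∀ y ∈ K, 0 ≤ (⟪Gf x, y - x⟫ : ℝ) → f x ≤ f y

/-- An `e`-quasiconvex function which does not increase from `x` to `y` has directional derivative
at most `e y x` at `x` in the direction `y - x`. -/
theorem EQuasiconvexOnR.inner_gradient_le {n : ℕ} {K : Set (En n)} {e : En n → En n → ℝ}
    {g : En n → ℝ} {x y G : En n} (hg : EQuasiconvexOnR K e g) (he : 0 ≤ e y x)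
    (hx : x ∈ K) (hy : y ∈ K) (hG : HasGradientAt g G x) (hyx : g y ≤ g x) :
    (⟪G, y - x⟫ : ℝ) ≤ e y x := by
  have hd : HasDerivAt (fun t : ℝ => g (x + t • (y - x))) (⟪G, y - x⟫ : ℝ) 0 := by
    simpa [HasLineDerivAt] using hG.hasFDerivAt.hasLineDerivAt (y - x)
  refine le_of_tendsto hd.tendsto_slope_zero_right ?_
  filter_upwards [Ioo_mem_nhdsGT (zero_lt_one' ℝ)] with t ht
  have hq := hg y hy x hx t ht
  have hline : t • y + (1 - t) • x = x + t • (y - x) := by module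
  rw [hline, max_eq_right hyx] at hq
  have ht0 : 0 < t := ht.1
  simp only [zero_add, zero_smul, add_zero, smul_eq_mul]
  rw [inv_mul_le_iff₀ ht0]
  nlinarith [mul_nonneg (mul_nonneg ht0.le ht0.le) he]

/-- sufficiency of the KKT conditions when `f` is pseudoconvex and
the constraints `gᵢ` are `eᵢ`-quasiconvex, with `eᵢ(·,y)` convex and `eᵢ(x,x) = 0`. -/
theorem stmt14 {n m : ℕ} (K C : Set (En n))
    (f : En n → ℝ) (g : Fin m → En n → ℝ)
    (Gf : En n → En n) (Gg : Fin m → En n)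
    (e : Fin m → En n → En n → ℝ)
    (xbar : En n) (ubar : Fin m → ℝ)
    (hK : IsOpen K) (hKcv : Convex ℝ K) (hxK : xbar ∈ K)
    (hC : C = {x ∈ K | ∀ i, g i x ≤ 0}) (hCcv : Convex ℝ C)
    (hGf : ∀ x ∈ K, HasGradientAt f (Gf x) x)
    (hpseudo : PseudoconvexOnR K f Gf)
    (he : ∀ i, IsErrorBifunR (e i))
    (hecv : ∀ i, ∀ y : En n, ConvexOn ℝ Set.univ (fun x => e i x y))
    (hezero : ∀ i, ∀ x : En n, e i x x = 0)
    (hgqc : ∀ i, EQuasiconvexOnR K (e i) (g i))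
    (hdg : ∀ i, HasGradientAt (g i) (Gg i) xbar)
    (hkkt1 : ∀ x ∈ C,
      (∑ i, ubar i * e i x xbar) ≤ ⟪Gf xbar + ∑ i, ubar i • Gg i, x - xbar⟫)
    (hkkt2 : (∑ i, ubar i * g i xbar) = 0)
    (hkkt3 : ∀ i, g i xbar ≤ 0)
    (hkkt4 : ∀ i, 0 ≤ ubar i) :
    ∀ x ∈ C, f xbar ≤ f x := by
  intro x hx
  have hxC := hx
  rw [hC] at hxC
  obtain ⟨hxK', hgx⟩ := hxC
  have hcompl : ∀ i, ubar i * g i xbar = 0 := fun i =>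
    (Finset.sum_eq_zero_iff_of_nonpos fun j _ =>
      mul_nonpos_of_nonneg_of_nonpos (hkkt4 j) (hkkt3 j)).1 hkkt2 i (Finset.mem_univ i)
  have hle : ∑ i, ubar i * (⟪Gg i, x - xbar⟫ : ℝ) ≤ ∑ i, ubar i * e i x xbar := by
    refine Finset.sum_le_sum fun i _ => ?_
    rcases mul_eq_zero.1 (hcompl i) with hu | hgi
    · simp [hu]
    · exact mul_le_mul_of_nonneg_left
        ((hgqc i).inner_gradient_le ((he i).1 x xbar) hxK hxK' (hdg i) (hgi ▸ hgx i)) (hkkt4 i)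
  have hmain := hkkt1 x hx
  simp only [inner_add_left, sum_inner, real_inner_smul_left] at hmain
  exact hpseudo xbar hxK x hxK' (by linarith)
end
end

section
/- Let K ⊆ ℝⁿ be an open convex set, f : K → ℝ pseudoconvex and differentiable at x̄ ∈ K, and gᵢ : K → ℝ quasiconvex and differentiable at x̄ for i = 1,…,m. Assume C := {x ∈ K : gᵢ(x) ≤ 0 for all i} is convex and there exists ū ∈ ℝᵐ such that: (i) ⟨∇f(x̄) + Σᵢ ūᵢ ∇gᵢ(x̄), x − x̄⟩ ≥ 0 for all x ∈ C; (ii) Σᵢ ūᵢ gᵢ(x̄) = 0; (iii) gᵢ(x̄) ≤ 0 for all i; (iv) ū ≥ 0. Then x̄ is a global minimum of f on C. -/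
/- Setting: real-valued functions on an open convex `K ⊆ ℝⁿ`;
`HasGradientAt φ Gφ x` is Mathlib's gradient for functions on a Hilbert space. -/

noncomputable section

open RealInnerProductSpace

/-- `g` is quasiconvex on the convex set `K`. -/
def QuasiconvexOnR {n : ℕ} (K : Set (En n)) (g : En n → ℝ) : Prop :=
  ∀ x ∈ K, ∀ y ∈ K, ∀ t ∈ Set.Icc (0:ℝ) 1,
    g (t • x + (1 - t) • y) ≤ max (g x) (g y)

/-- First-order condition for quasiconvexity at a point of differentiability. -/
theorem QuasiconvexOnR.inner_gradient_nonpos {n : ℕ} {K : Set (En n)} {g : En n → ℝ}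
    (hg : QuasiconvexOnR K g) {x y G : En n} (hx : x ∈ K) (hy : y ∈ K)
    (hG : HasGradientAt g G x) (hle : g y ≤ g x) : (⟪G, y - x⟫ : ℝ) ≤ 0 := by
  have hmax : IsLocalMaxOn g (segment ℝ x y) x := by
    refine IsMaxOn.localize fun z hz => ?_
    obtain ⟨a, b, ha, hb, hab, rfl⟩ := hz
    obtain rfl : b = 1 - a := by linarith
    exact (hg x hx y hy a ⟨ha, by linarith⟩).trans (max_le le_rfl hle)
  simpa using hmax.hasFDerivWithinAt_nonpos hG.hasFDerivAt.hasFDerivWithinAt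
    (sub_mem_posTangentConeAt_of_segment_subset subset_rfl)

/-- sufficiency of the KKT conditions when `f` is pseudoconvex and
the constraints `gᵢ` are quasiconvex. -/
theorem stmt15 {n m : ℕ} (K C : Set (En n))
    (f : En n → ℝ) (g : Fin m → En n → ℝ)
    (Gf : En n → En n) (Gg : Fin m → En n)
    (xbar : En n) (ubar : Fin m → ℝ)
    (hK : IsOpen K) (hKcv : Convex ℝ K) (hxK : xbar ∈ K)
    (hC : C = {x ∈ K | ∀ i, g i x ≤ 0}) (hCcv : Convex ℝ C)
    (hGf : ∀ x ∈ K, HasGradientAt f (Gf x) x)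
    (hpseudo : PseudoconvexOnR K f Gf)
    (hgqc : ∀ i, QuasiconvexOnR K (g i))
    (hdg : ∀ i, HasGradientAt (g i) (Gg i) xbar)
    (hkkt1 : ∀ x ∈ C, 0 ≤ (⟪Gf xbar + ∑ i, ubar i • Gg i, x - xbar⟫ : ℝ))
    (hkkt2 : (∑ i, ubar i * g i xbar) = 0)
    (hkkt3 : ∀ i, g i xbar ≤ 0)
    (hkkt4 : ∀ i, 0 ≤ ubar i) :
    ∀ x ∈ C, f xbar ≤ f x := by
  subst hC
  intro x hx
  have hterm : ∀ i, ubar i * g i xbar = 0 := fun i =>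
    (Finset.sum_eq_zero_iff_of_nonpos fun j _ =>
      mul_nonpos_of_nonneg_of_nonpos (hkkt4 j) (hkkt3 j)).1 hkkt2 i (Finset.mem_univ i)
  have hsum : ∑ i, ubar i * (⟪Gg i, x - xbar⟫ : ℝ) ≤ 0 := by
    refine Finset.sum_nonpos fun i _ => ?_
    rcases mul_eq_zero.1 (hterm i) with h | h
    · simp [h]
    · exact mul_nonpos_of_nonneg_of_nonpos (hkkt4 i)
        ((hgqc i).inner_gradient_nonpos hxK hx.1 (hdg i) (h ▸ hx.2 i))
  have hkkt := hkkt1 x hx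
  simp only [inner_add_left, sum_inner, real_inner_smul_left] at hkkt
  exact hpseudo xbar hxK x hx.1 (by linarith)
end
end
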